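/- Let G be the disjoint union of graphs G₀ = (V₀, I₀) and G₁ = (V₁, I₁) (so V = V₀ ⊔ V₁, I = I₀ ∪ I₁, and no symbol of V₀ is I-related to a symbol of V₁). Let S = (Q, →) be a valence system over 𝕄 and let S' = (Q, ⇝) where ⇝ is the least transition relation containing → and closed under the rule: if for some i ∈ {0,1} there is a run of (Q, ⇝) from (p, ε) to (q, w) for some w ∈ Ops_i* with ⟦w⟧ = 1, then (p, ε, q) ∈ ⇝. Then for all states q_init, q_fin ∈ Q: q_fin is reachable from q_init using only ε-labeled transitions of S' if and only if there is a run of S from (q_init, ε) to (q_fin, w) for some w ∈ Ops* with ⟦w⟧ = 1. -/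

import Mathlib

/-- Operations on the symbols of a graph: a positive (`o⁺`) and a negative (`o⁻`)
operation for each symbol `o`. -/
inductive Op (V : Type) : Type
  | pos : V → Op V
  | neg : V → Op V

/-- The underlying symbol of an operation. -/
def Op.sym {V : Type} : Op V → V
  | .pos o => o
  | .neg o => o
/-- The generating relation of the graph monoid congruence, closed under contexts:
swap two adjacent independent operations, or cancel an adjacent pair `o⁺ o⁻`. -/
inductive MGen {V : Type} (I : V → V → Prop) : List (Op V) → List (Op V) → Prop
  | swap (s t : List (Op V)) (a b : Op V) (h : I a.sym b.sym) :
      MGen I (s ++ [a, b] ++ t) (s ++ [b, a] ++ t)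
  | cancel (s t : List (Op V)) (o : V) :
      MGen I (s ++ [Op.pos o, Op.neg o] ++ t) (s ++ t)

/-- The monoid congruence `≅` on computations: the smallest congruence containing
`o₁^± o₂^± ≅ o₂^± o₁^±` for `(o₁,o₂) ∈ I` and `o⁺ o⁻ ≅ ε`.  In particular
`MCong I w []` expresses `⟦w⟧ = 1`. -/
def MCong {V : Type} (I : V → V → Prop) : List (Op V) → List (Op V) → Prop :=
  Relation.EqvGen (MGen I)
/-- A computation is right-invertible if it can be completed to one that evaluates
to `1` in the graph monoid. -/
def RightInvertible {V : Type} (I : V → V → Prop) (w : List (Op V)) : Prop :=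
  ∃ w' : List (Op V), MCong I (w ++ w') []

/-- `VRun I T p q w`: a run of the valence system with transition relation `T`
from configuration `(p, ε)` to configuration `(q, w)`; every configuration along
the run must be right-invertible. -/
inductive VRun {V Q : Type} (I : V → V → Prop) (T : Q → Option (Op V) → Q → Prop) :
    Q → Q → List (Op V) → Prop
  | refl (q : Q) : VRun I T q q []
  | step {p q r : Q} {w : List (Op V)} (x : Option (Op V)) :
      VRun I T p q w → T q x r → RightInvertible I (w ++ x.toList) →
      VRun I T p r (w ++ x.toList)

mutual
  /-- The saturated transition relation `⇝` of `S' = (Q, ⇝)`: the least relation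
  containing the transitions `T` of `S` and closed under the rule that if `(Q, ⇝)`
  has a run from `(p, ε)` to `(q, w)` where `w` uses only operations of one part
  `G_i` of the disjoint union and `⟦w⟧ = 1`, then there is an ε-transition `p ⇝ q`. -/
  inductive SatU {V Q : Type} (I : V → V → Prop) (P : V → Bool)
      (T : Q → Option (Op V) → Q → Prop) : Q → Option (Op V) → Q → Prop
    | base {p : Q} {x : Option (Op V)} {q : Q} : T p x q → SatU I P T p x q
    | shortcut {p q : Q} (i : Bool) (w : List (Op V)) :
        (∀ a ∈ w, P (Op.sym a) = i) → MCong I w [] →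
        SatURun I P T p q w → SatU I P T p none q

  /-- Runs of the saturated system `(Q, ⇝)` from `(p, ε)` to `(q, w)`; every
  configuration along the run must be right-invertible. -/
  inductive SatURun {V Q : Type} (I : V → V → Prop) (P : V → Bool)
      (T : Q → Option (Op V) → Q → Prop) : Q → Q → List (Op V) → Prop
    | refl (q : Q) : SatURun I P T q q []
    | step {p q r : Q} {w : List (Op V)} (x : Option (Op V)) :
        SatURun I P T p q w → SatU I P T q x r →
        RightInvertible I (w ++ x.toList) → SatURun I P T p r (w ++ x.toList)
end

open Relation

namespace MCong

variable {V : Type} {I : V → V → Prop}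

theorem of_gen {u v : List (Op V)} (h : MGen I u v) : MCong I u v := EqvGen.rel _ _ h

theorem refl (w : List (Op V)) : MCong I w w := EqvGen.refl w

theorem symm {u v : List (Op V)} (h : MCong I u v) : MCong I v u := EqvGen.symm _ _ h

theorem trans {u v w : List (Op V)} (h : MCong I u v) (h' : MCong I v w) : MCong I u w :=
  EqvGen.trans _ _ _ h h'

theorem append_left (c : List (Op V)) {u v : List (Op V)} (h : MCong I u v) :
    MCong I (c ++ u) (c ++ v) := by
  induction h with
  | rel _ _ h =>
    cases h with
    | swap s t a b h => simpa using MCong.of_gen (MGen.swap (c ++ s) t a b h)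
    | cancel s t o => simpa using MCong.of_gen (MGen.cancel (I := I) (c ++ s) t o)
  | refl _ => exact refl _
  | symm _ _ _ ih => exact ih.symm
  | trans _ _ _ _ _ ih ih₂ => exact ih.trans ih₂

theorem append_right {u v : List (Op V)} (h : MCong I u v) (c : List (Op V)) :
    MCong I (u ++ c) (v ++ c) := by
  induction h with
  | rel _ _ h =>
    cases h with
    | swap s t a b h => simpa using MCong.of_gen (MGen.swap s (t ++ c) a b h)
    | cancel s t o => simpa using MCong.of_gen (MGen.cancel (I := I) s (t ++ c) o)
  | refl _ => exact refl _
  | symm _ _ _ ih => exact ih.symm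
  | trans _ _ _ _ _ ih ih₂ => exact ih.trans ih₂

theorem append {u v u' v' : List (Op V)} (h : MCong I u v) (h' : MCong I u' v') :
    MCong I (u ++ u') (v ++ v') :=
  (h.append_right u').trans (h'.append_left v)

theorem rightInvertible {w : List (Op V)} (h : MCong I w []) : RightInvertible I w :=
  ⟨[], by simpa using h⟩

/-- The congruence `≅` as a congruence of the free monoid on the operations. -/
def con (I : V → V → Prop) : Con (FreeMonoid (Op V)) where
  r u v := MCong I u.toList v.toList
  iseqv := ⟨fun _ => refl _, symm, trans⟩
  mul' h h' := h.append h'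

end MCong

theorem RightInvertible.of_append {V : Type} {I : V → V → Prop} {u v : List (Op V)}
    (h : RightInvertible I (u ++ v)) : RightInvertible I u := by
  obtain ⟨w, hw⟩ := h
  exact ⟨v ++ w, by simpa using hw⟩

/-- The graph monoid of the graph with vertices `V` and edges `I`. -/
abbrev GraphMonoid {V : Type} (I : V → V → Prop) : Type := (MCong.con I).Quotient

namespace GraphMonoid

open Monoid

variable {V : Type} {I : V → V → Prop} {P : V → Bool}

/-- The class of a computation in the graph monoid. -/
def mk (I : V → V → Prop) (w : List (Op V)) : GraphMonoid I :=
  (MCong.con I).mk' (FreeMonoid.ofList w)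

theorem mk_append (u v : List (Op V)) : mk I (u ++ v) = mk I u * mk I v := by
  simp [mk]

theorem mk_eq_mk {u v : List (Op V)} : mk I u = mk I v ↔ MCong I u v :=
  (MCong.con I).eq

theorem mk_eq_one {w : List (Op V)} : mk I w = 1 ↔ MCong I w [] :=
  mk_eq_mk (v := [])

/-- The value of a computation in the free product of two copies of the graph monoid, where an
operation is sent to the copy given by the part of its symbol. -/
def toCoprod (I : V → V → Prop) (P : V → Bool) (w : List (Op V)) :
    CoprodI fun _ : Bool => GraphMonoid I :=
  (w.map fun a => CoprodI.of (M := fun _ : Bool => GraphMonoid I) (i := P a.sym) (mk I [a])).prod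

theorem toCoprod_append (u v : List (Op V)) :
    toCoprod I P (u ++ v) = toCoprod I P u * toCoprod I P v := by
  simp [toCoprod]

theorem toCoprod_of_part (i : Bool) {w : List (Op V)} (h : ∀ a ∈ w, P a.sym = i) :
    toCoprod I P w = CoprodI.of (M := fun _ : Bool => GraphMonoid I) (i := i) (mk I w) := by
  induction w with
  | nil => exact (map_one _).symm
  | cons a w ih =>
    obtain ⟨ha, hw⟩ := List.forall_mem_cons.1 h
    rw [← List.singleton_append, toCoprod_append, ih hw, mk_append, map_mul]
    subst ha
    simp [toCoprod]

theorem toCoprod_eq_of_mCong (hcross : ∀ o₁ o₂ : V, P o₁ ≠ P o₂ → ¬ I o₁ o₂)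
    {u v : List (Op V)} (h : MCong I u v) : toCoprod I P u = toCoprod I P v := by
  induction h with
  | rel _ _ h =>
    cases h with
    | swap s t a b h =>
      have hab : P a.sym = P b.sym := by
        by_contra hne
        exact hcross _ _ hne h
      have hmk : mk I [a, b] = mk I [b, a] :=
        mk_eq_mk.2 (MCong.of_gen (MGen.swap [] [] a b h))
      rw [toCoprod_append, toCoprod_append, toCoprod_append, toCoprod_append,
        toCoprod_of_part (P := P) (w := [a, b]) (P b.sym) (by simp [hab]),
        toCoprod_of_part (P := P) (w := [b, a]) (P b.sym) (by simp [hab]), hmk]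
    | cancel s t o =>
      have hmk : mk I [Op.pos o, Op.neg o] = 1 :=
        mk_eq_one.2 (MCong.of_gen (MGen.cancel [] [] o))
      rw [toCoprod_append, toCoprod_append, toCoprod_append,
        toCoprod_of_part (P := P) (w := [Op.pos o, Op.neg o]) (P o) (by simp [Op.sym]), hmk,
        map_one, mul_one]
  | refl _ => rfl
  | symm _ _ _ ih => exact ih.symm
  | trans _ _ _ _ _ ih ih₂ => exact ih.trans ih₂

/-- A nonempty computation without nonempty factors that use a single part and evaluate to `1`
splits off its first block so that the rest is represented by a reduced word that does not start
in the part of that block. -/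
theorem exists_block_word (w : List (Op V)) (hne : w ≠ [])
    (h : ∀ (i : Bool) (u b v : List (Op V)), w = u ++ b ++ v → b ≠ [] →
      (∀ a ∈ b, P a.sym = i) → ¬ MCong I b []) :
    ∃ (i : Bool) (b v : List (Op V)) (W : CoprodI.Word fun _ : Bool => GraphMonoid I),
      w = b ++ v ∧ b ≠ [] ∧ (∀ a ∈ b, P a.sym = i) ∧ W.fstIdx ≠ some i ∧
        W.prod = toCoprod I P v := by
  induction w with
  | nil => exact absurd rfl hne
  | cons a w ih =>
    rcases eq_or_ne w [] with rfl | hw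
    · exact ⟨P a.sym, [a], [], CoprodI.Word.empty, by simp, by simp, by simp,
        by simp [CoprodI.Word.fstIdx, CoprodI.Word.empty], by simp [toCoprod]⟩
    obtain ⟨i, b, v, W, rfl, hb, hbi, hW, hprod⟩ := ih hw fun i u b v e =>
      h i (a :: u) b v (by simp [e])
    by_cases hai : P a.sym = i
    · exact ⟨i, a :: b, v, W, by simp, by simp, by simpa [hai] using hbi, hW, hprod⟩
    · have hb1 : mk I b ≠ 1 := fun e => h i [a] b v (by simp) hb hbi (mk_eq_one.1 e)
      refine ⟨P a.sym, [a], b ++ v, CoprodI.Word.cons (i := i) (mk I b) W hW hb1, by simp,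
        by simp, by simp, ?_, ?_⟩
      · simpa [CoprodI.Word.fstIdx, CoprodI.Word.cons] using Ne.symm hai
      · rw [CoprodI.Word.prod_cons, hprod, toCoprod_append, toCoprod_of_part i hbi]

/-- A nonempty computation that evaluates to `1` has a nonempty factor that uses a single part
and evaluates to `1`. -/
theorem exists_factor_mCong_nil (hcross : ∀ o₁ o₂ : V, P o₁ ≠ P o₂ → ¬ I o₁ o₂)
    {w : List (Op V)} (hne : w ≠ []) (hw : MCong I w []) :
    ∃ (i : Bool) (u b v : List (Op V)), w = u ++ b ++ v ∧ b ≠ [] ∧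
      (∀ a ∈ b, P a.sym = i) ∧ MCong I b [] := by
  classical
  by_contra! hcon
  obtain ⟨i, b, v, W, rfl, hb, hbi, hW, hprod⟩ := exists_block_word w hne hcon
  have hb1 : mk I b ≠ 1 := fun e => hcon i [] b v (by simp) hb hbi (mk_eq_one.1 e)
  have hcons : (CoprodI.Word.cons (i := i) (mk I b) W hW hb1).prod =
      (CoprodI.Word.empty : CoprodI.Word fun _ : Bool => GraphMonoid I).prod := by
    rw [CoprodI.Word.prod_cons, hprod, ← toCoprod_of_part i hbi, ← toCoprod_append,
      toCoprod_eq_of_mCong hcross hw, CoprodI.Word.prod_empty]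
    simp [toCoprod]
  have hinj : Function.Injective
      (CoprodI.Word.prod : CoprodI.Word (fun _ : Bool => GraphMonoid I) → _) :=
    CoprodI.Word.equiv.symm.injective
  have := congrArg CoprodI.Word.toList (hinj hcons)
  simp [CoprodI.Word.cons, CoprodI.Word.empty] at this

end GraphMonoid

/-- Paths of a transition relation together with their labels, with no condition on the
configurations along the path. -/
inductive VPath {V Q : Type} (T : Q → Option (Op V) → Q → Prop) : Q → Q → List (Op V) → Prop
  | refl (q : Q) : VPath T q q []
  | step {p q r : Q} {w : List (Op V)} (x : Option (Op V)) :
      VPath T p q w → T q x r → VPath T p r (w ++ x.toList)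

namespace VPath

variable {V Q : Type} {I : V → V → Prop} {P : V → Bool} {T : Q → Option (Op V) → Q → Prop}
  {p q r : Q}

theorem single {x : Option (Op V)} (h : T p x q) : VPath T p q x.toList :=
  step x (refl p) h

theorem append {u v : List (Op V)} (h : VPath T p q u) (h' : VPath T q r v) :
    VPath T p r (u ++ v) := by
  induction h' with
  | refl => simpa using h
  | step x _ hT ih =>
    rw [← List.append_assoc]
    exact step x ih hT

theorem exists_of_append {u v : List (Op V)} (h : VPath T p r (u ++ v)) :
    ∃ q, VPath T p q u ∧ VPath T q r v := by
  generalize e : u ++ v = w at h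
  induction h generalizing v with
  | refl =>
    obtain ⟨rfl, rfl⟩ := List.append_eq_nil_iff.1 e
    exact ⟨_, refl _, refl _⟩
  | @step q r w x h hT ih =>
    cases x with
    | none =>
      obtain ⟨m, h₁, h₂⟩ := ih (by simpa using e)
      exact ⟨m, h₁, by simpa using step none h₂ hT⟩
    | some a =>
      rcases List.eq_nil_or_concat v with rfl | ⟨v, b, rfl⟩
      · rw [List.append_nil] at e
        exact ⟨r, e ▸ step (some a) h hT, refl r⟩
      · rw [List.concat_eq_append, ← List.append_assoc] at e
        obtain ⟨e, hb⟩ := List.append_inj' e rfl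
        obtain ⟨m, h₁, h₂⟩ := ih e
        exact ⟨m, h₁, by simpa [hb] using step (some a) h₂ hT⟩

theorem mono {T' : Q → Option (Op V) → Q → Prop} (hT : ∀ p x q, T p x q → T' p x q)
    {w : List (Op V)} (h : VPath T p q w) : VPath T' p q w := by
  induction h with
  | refl => exact refl _
  | step x _ h ih => exact step x ih (hT _ _ _ h)

theorem reflTransGen (h : VPath T p q []) : ReflTransGen (fun p q => T p none q) p q := by
  generalize e : [] = w at h
  induction h with
  | refl => exact ReflTransGen.refl
  | step x _ h ih =>
    cases x with
    | none => exact (ih (by simpa using e)).tail h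
    | some a => simp at e

theorem vRun {w : List (Op V)} (h : VPath T p q w) (hw : RightInvertible I w) :
    VRun I T p q w := by
  induction h with
  | refl => exact VRun.refl _
  | step x _ h ih => exact VRun.step x (ih hw.of_append) h hw

theorem satURun {w : List (Op V)} (h : VPath (SatU I P T) p q w) (hw : RightInvertible I w) :
    SatURun I P T p q w := by
  induction h with
  | refl => exact SatURun.refl _
  | step x _ h ih => exact SatURun.step x (ih hw.of_append) h hw

/-- A path of the saturated system whose label evaluates to `1` can be replaced by
`ε`-transitions of the saturated system. -/
theorem reflTransGen_satU (hcross : ∀ o₁ o₂ : V, P o₁ ≠ P o₂ → ¬ I o₁ o₂)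
    {w : List (Op V)} (h : VPath (SatU I P T) p q w) (hw : MCong I w []) :
    ReflTransGen (fun p q => SatU I P T p none q) p q := by
  induction hn : w.length using Nat.strong_induction_on generalizing w with
  | _ n ih =>
    rcases eq_or_ne w [] with rfl | hne
    · exact h.reflTransGen
    obtain ⟨i, u, b, v, rfl, hb, hbi, hb1⟩ :=
      GraphMonoid.exists_factor_mCong_nil hcross hne hw
    obtain ⟨m₂, h₁₂, h₃⟩ := h.exists_of_append
    obtain ⟨m₁, h₁, h₂⟩ := h₁₂.exists_of_append
    have hε : SatU I P T m₁ none m₂ :=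
      SatU.shortcut i b hbi hb1 (h₂.satURun hb1.rightInvertible)
    have huv : MCong I (u ++ v) (u ++ b ++ v) := by
      simpa using ((hb1.append_left u).append_right v).symm
    refine ih _ ?_ (h₁.append ((single hε).append h₃)) (by simpa using huv.trans hw) rfl
    have := List.length_pos_of_ne_nil hb
    simp at hn ⊢
    omega

end VPath

section

variable {V Q : Type} {I : V → V → Prop} {P : V → Bool} {T : Q → Option (Op V) → Q → Prop}

theorem VRun.vPath {p q : Q} {w : List (Op V)} (h : VRun I T p q w) : VPath T p q w := by
  induction h with
  | refl => exact VPath.refl _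
  | step x _ h _ ih => exact VPath.step x ih h

mutual

theorem SatU.exists_vPath {p q : Q} {x : Option (Op V)} (h : SatU I P T p x q) :
    ∃ w, VPath T p q w ∧ MCong I w x.toList :=
  match h with
  | .base h => ⟨_, VPath.single h, MCong.refl _⟩
  | .shortcut _ _ _ hw h =>
    let ⟨w', h', hw'⟩ := SatURun.exists_vPath h
    ⟨w', h', hw'.trans hw⟩

theorem SatURun.exists_vPath {p q : Q} {w : List (Op V)} (h : SatURun I P T p q w) :
    ∃ w', VPath T p q w' ∧ MCong I w' w :=
  match h with
  | .refl q => ⟨[], VPath.refl q, MCong.refl _⟩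
  | .step _ h hx _ =>
    let ⟨u, hu, hu'⟩ := SatURun.exists_vPath h
    let ⟨v, hv, hv'⟩ := SatU.exists_vPath hx
    ⟨u ++ v, hu.append hv, hu'.append hv'⟩

end

end

/-- **Correctness of the saturation for disjoint unions.**  Let `G` be the disjoint
union of `G₀` and `G₁` (parts given by `P : V → Bool`, no independence across parts)
and let `S = (Q, T)` be a valence system over `𝕄`.  Then `q_fin` is reachable from
`q_init` by ε-labeled transitions of the saturated system iff `S` has a run from
`(q_init, ε)` to `(q_fin, w)` for some `w` with `⟦w⟧ = 1`. -/
theorem saturation_union_correct {V Q : Type} [Finite Q] (I : V → V → Prop)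
    (hsym : ∀ a b : V, I a b → I b a)
    (P : V → Bool)
    (hcross : ∀ o₁ o₂ : V, P o₁ ≠ P o₂ → ¬ I o₁ o₂)
    (T : Q → Option (Op V) → Q → Prop)
    (qinit qfin : Q) :
    Relation.ReflTransGen (fun p q => SatU I P T p none q) qinit qfin ↔
      ∃ w : List (Op V), VRun I T qinit qfin w ∧ MCong I w [] := by
  constructor
  · intro h
    suffices ∃ w, VPath T qinit qfin w ∧ MCong I w [] by
      obtain ⟨w, h, hw⟩ := this
      exact ⟨w, h.vRun hw.rightInvertible, hw⟩
    induction h with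
    | refl => exact ⟨[], VPath.refl _, MCong.refl _⟩
    | tail _ h ih =>
      obtain ⟨u, hu, hu'⟩ := ih
      obtain ⟨v, hv, hv'⟩ := h.exists_vPath
      exact ⟨u ++ v, hu.append hv, hu'.append hv'⟩
  · rintro ⟨w, h, hw⟩
    exact (h.vPath.mono fun _ _ _ => SatU.base).reflTransGen_satU hcross hw
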